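/- For α, β ≥ -1 and each integer l ≥ 1: lim_{n→∞} n^l · T_{n,2l-1}^{α,β}(x) = X^{l-1}·[(l-1)!·2^{l-1}·(1-2x)·Σ_{k=1}^{l-1} (2k-1)!!/(2k-2)!! + (2l-1)!!·(α+1-(α+β+2)x)], uniformly for x ∈ [0,1], where X = x(1-x). -/

import Mathlib

open MeasureTheory intervalIntegral Filter

/-- The Beta operator with Jacobi weights: `B_n^{α,β}(f;x)`. -/
noncomputable def Bop (n α β : ℝ) (f : ℝ → ℝ) (x : ℝ) : ℝ :=
  (∫ t in (0:ℝ)..1, t ^ (n * x + α) * (1 - t) ^ (n - n * x + β) * f t) /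
  (∫ t in (0:ℝ)..1, t ^ (n * x + α) * (1 - t) ^ (n - n * x + β))

/-- The `m`-th central moment `T_{n,m}^{α,β}(x)`. -/
noncomputable def T (n α β : ℝ) (m : ℕ) (x : ℝ) : ℝ :=
  Bop n α β (fun t => (t - x) ^ m) x


/-- The Beta operator extended to the limiting cases `α = -1` (interpolation at `0`)
and `β = -1` (interpolation at `1`). -/
noncomputable def BopE (n α β : ℝ) (f : ℝ → ℝ) (x : ℝ) : ℝ :=
  if α = -1 ∧ x = 0 then f 0
  else if β = -1 ∧ x = 1 then f 1
  else Bop n α β f x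

/-- The `m`-th central moment of the extended Beta operator. -/
noncomputable def TE (n α β : ℝ) (m : ℕ) (x : ℝ) : ℝ :=
  BopE n α β (fun t => (t - x) ^ m) x

section

open Asymptotics Set

theorem intervalIntegrable_rpow_mul_one_sub_rpow_left {p : ℝ} (hp : -1 < p) (q : ℝ) :
    IntervalIntegrable (fun t : ℝ => t ^ p * (1 - t) ^ q) volume 0 (1 / 2) := by
  apply IntervalIntegrable.mul_continuousOn (intervalIntegrable_rpow' hp)
  intro t ht
  rw [uIcc_of_le (by positivity : (0 : ℝ) ≤ 1 / 2)] at ht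
  have h : (1 - t) ≠ 0 := by linarith [ht.2]
  exact (ContinuousAt.rpow_const (by fun_prop) (Or.inl h)).continuousWithinAt

theorem intervalIntegrable_rpow_mul_one_sub_rpow {p q : ℝ} (hp : -1 < p) (hq : -1 < q) :
    IntervalIntegrable (fun t : ℝ => t ^ p * (1 - t) ^ q) volume 0 1 := by
  refine (intervalIntegrable_rpow_mul_one_sub_rpow_left hp q).trans ?_
  have h := ((intervalIntegrable_rpow_mul_one_sub_rpow_left hq p).comp_sub_left 1).symm
  norm_num at h ⊢
  simpa only [mul_comm] using h

theorem integral_rpow_mul_one_sub_rpow_pos {p q : ℝ} (hp : -1 < p) (hq : -1 < q) :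
    0 < ∫ t in (0 : ℝ)..1, t ^ p * (1 - t) ^ q := by
  refine intervalIntegral_pos_of_pos_on (intervalIntegrable_rpow_mul_one_sub_rpow hp hq) ?_ one_pos
  intro t ht
  exact mul_pos (Real.rpow_pos_of_pos ht.1 _) (Real.rpow_pos_of_pos (sub_pos.2 ht.2) _)

/-- Recurrence for the unnormalized central moments of the Beta density. -/
theorem integral_rpow_mul_one_sub_rpow_mul_sub_pow_succ {p q : ℝ} (hp : -1 < p) (hq : -1 < q)
    (x : ℝ) (m : ℕ) :
    (p + q + 2 + m) * ∫ t in (0 : ℝ)..1, t ^ p * (1 - t) ^ q * (t - x) ^ (m + 1) =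
      (p + 1 - (p + q + 2) * x + m * (1 - 2 * x)) *
          (∫ t in (0 : ℝ)..1, t ^ p * (1 - t) ^ q * (t - x) ^ m) +
        m * (x * (1 - x)) * ∫ t in (0 : ℝ)..1, t ^ p * (1 - t) ^ q * (t - x) ^ (m - 1) := by
  have hint : ∀ g : ℝ → ℝ, Continuous g →
      IntervalIntegrable (fun t : ℝ => t ^ p * (1 - t) ^ q * g t) volume 0 1 := fun g hg =>
    (intervalIntegrable_rpow_mul_one_sub_rpow hp hq).mul_continuousOn hg.continuousOn
  have hFTC := integral_eq_sub_of_hasDerivAt_of_le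
    (f := fun t : ℝ => t ^ (p + 1) * (1 - t) ^ (q + 1) * (t - x) ^ m)
    (f' := fun t : ℝ => t ^ p * (1 - t) ^ q *
      (((p + 1) * (1 - t) - (q + 1) * t) * (t - x) ^ m +
        m * (t * (1 - t)) * (t - x) ^ (m - 1))) zero_le_one
    (by
      have h₁ : Continuous fun t : ℝ => t ^ (p + 1) :=
        Real.continuous_rpow_const (by linarith)
      have h₂ : Continuous fun t : ℝ => (1 - t) ^ (q + 1) :=
        (Real.continuous_rpow_const (by linarith)).comp (by fun_prop)
      exact ((h₁.mul h₂).mul (by fun_prop)).continuousOn)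
    (by
      intro t ht
      have h0 : t ≠ 0 := ht.1.ne'
      have h1 : 1 - t ≠ 0 := (sub_pos.2 ht.2).ne'
      have d₁ := (hasDerivAt_id t).rpow_const (p := p + 1) (Or.inl h0)
      have d₂ := ((hasDerivAt_id t).const_sub 1).rpow_const (p := q + 1) (Or.inl h1)
      have d₃ := ((hasDerivAt_id t).sub_const x).pow m
      refine ((d₁.mul d₂).mul d₃).congr_deriv ?_
      simp only [id, Pi.mul_apply, Pi.pow_apply, add_sub_cancel_right,
        Real.rpow_add_one h0, Real.rpow_add_one h1]
      ring)
    (hint _ (by fun_prop))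
  have hz : (0 : ℝ) ^ (p + 1) = 0 := Real.zero_rpow (by linarith)
  have hz' : (0 : ℝ) ^ (q + 1) = 0 := Real.zero_rpow (by linarith)
  simp only [hz, hz', sub_self, zero_mul, mul_zero] at hFTC
  have hsplit : ∀ t : ℝ, t ^ p * (1 - t) ^ q *
      (((p + 1) * (1 - t) - (q + 1) * t) * (t - x) ^ m + m * (t * (1 - t)) * (t - x) ^ (m - 1)) =
      (p + 1 - (p + q + 2) * x + m * (1 - 2 * x)) * (t ^ p * (1 - t) ^ q * (t - x) ^ m) +
        m * (x * (1 - x)) * (t ^ p * (1 - t) ^ q * (t - x) ^ (m - 1)) -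
        (p + q + 2 + m) * (t ^ p * (1 - t) ^ q * (t - x) ^ (m + 1)) := by
    intro t
    rcases m with _ | m
    · simp; ring
    · simp only [Nat.add_sub_cancel]; ring
  have hi : ∀ k : ℕ, IntervalIntegrable
      (fun t : ℝ => t ^ p * (1 - t) ^ q * (t - x) ^ k) volume 0 1 := fun k =>
    hint _ (by fun_prop)
  simp only [hsplit] at hFTC
  rw [integral_sub (((hi _).const_mul _).add ((hi _).const_mul _)) ((hi _).const_mul _),
    integral_add ((hi _).const_mul _) ((hi _).const_mul _), intervalIntegral.integral_const_mul,
    intervalIntegral.integral_const_mul, intervalIntegral.integral_const_mul] at hFTC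
  linarith

theorem neg_one_lt_exponents {α β n x : ℝ} (hα : -1 ≤ α) (hβ : -1 ≤ β) (hn : 0 < n)
    (hx : x ∈ Icc (0 : ℝ) 1) (h0 : ¬(α = -1 ∧ x = 0)) (h1 : ¬(β = -1 ∧ x = 1)) :
    -1 < n * x + α ∧ -1 < n - n * x + β := by
  constructor
  · rcases hα.lt_or_eq with h | h
    · nlinarith [mul_nonneg hn.le hx.1]
    · have : 0 < x := lt_of_le_of_ne hx.1 fun e => h0 ⟨h.symm, e.symm⟩
      nlinarith [mul_pos hn this]
  · rcases hβ.lt_or_eq with h | h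
    · nlinarith [mul_nonneg hn.le (sub_nonneg.2 hx.2)]
    · have : x < 1 := lt_of_le_of_ne hx.2 fun e => h1 ⟨h.symm, e⟩
      nlinarith [mul_pos hn (sub_pos.2 this)]

theorem TE_zero {α β n x : ℝ} (hα : -1 ≤ α) (hβ : -1 ≤ β) (hn : 0 < n)
    (hx : x ∈ Icc (0 : ℝ) 1) : TE n α β 0 x = 1 := by
  unfold TE BopE
  split_ifs with h0 h1
  · simp
  · simp
  · obtain ⟨hp, hq⟩ := neg_one_lt_exponents hα hβ hn hx h0 h1
    simpa [Bop] using div_self (integral_rpow_mul_one_sub_rpow_pos hp hq).ne'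

/-- Three-term recurrence for the central moments. -/
theorem TE_succ {α β n x : ℝ} (hα : -1 ≤ α) (hβ : -1 ≤ β) (hn : 0 < n)
    (hx : x ∈ Icc (0 : ℝ) 1) (m : ℕ) :
    TE n α β (m + 1) x = (n + (α + β + 2 + m))⁻¹ *
      ((α + 1 - (α + β + 2) * x + m * (1 - 2 * x)) * TE n α β m x +
        m * (x * (1 - x)) * TE n α β (m - 1) x) := by
  unfold TE BopE
  split_ifs with h0 h1
  · obtain ⟨rfl, rfl⟩ := h0
    rcases m with _ | m <;> simp
  · obtain ⟨rfl, rfl⟩ := h1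
    rcases m with _ | m
    · simp only [sub_self, zero_add, pow_one, CharP.cast_eq_zero]
      ring
    · simp
  · obtain ⟨hp, hq⟩ := neg_one_lt_exponents hα hβ hn hx h0 h1
    have hm : (0 : ℝ) ≤ m := m.cast_nonneg
    have hne : n + (α + β + 2 + m) ≠ 0 := by linarith
    have hI := (integral_rpow_mul_one_sub_rpow_pos hp hq).ne'
    have h := integral_rpow_mul_one_sub_rpow_mul_sub_pow_succ hp hq x m
    unfold Bop
    generalize (∫ t in (0 : ℝ)..1, t ^ (n * x + α) * (1 - t) ^ (n - n * x + β)) = I at hI ⊢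
    generalize (∫ t in (0 : ℝ)..1, t ^ (n * x + α) * (1 - t) ^ (n - n * x + β) *
      (t - x) ^ (m + 1)) = I₁ at h ⊢
    generalize (∫ t in (0 : ℝ)..1, t ^ (n * x + α) * (1 - t) ^ (n - n * x + β) *
      (t - x) ^ m) = I₂ at h ⊢
    generalize (∫ t in (0 : ℝ)..1, t ^ (n * x + α) * (1 - t) ^ (n - n * x + β) *
      (t - x) ^ (m - 1)) = I₃ at h ⊢
    rw [eq_inv_mul_iff_mul_eq₀ hne]
    field_simp
    linear_combination h

theorem tendsto_mul_add_mul_of_isBigO_one {ι : Type*} {L : Filter ι} {r A B F G f g : ι → ℝ}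
    (hr : Tendsto r L (nhds 1)) (hA : A =O[L] (1 : ι → ℝ)) (hB : B =O[L] (1 : ι → ℝ))
    (hf : f =O[L] (1 : ι → ℝ)) (hg : g =O[L] (1 : ι → ℝ))
    (hF : (F - f) =o[L] (1 : ι → ℝ)) (hG : (G - g) =o[L] (1 : ι → ℝ)) :
    (r * (A * F + B * G) - (A * f + B * g)) =o[L] (1 : ι → ℝ) := by
  have hr1 : (r - 1) =o[L] (1 : ι → ℝ) := by
    refine (isLittleO_one_iff ℝ).2 ?_
    rw [← sub_self (1 : ℝ)]
    exact hr.sub tendsto_const_nhds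
  have hrO : r =O[L] (1 : ι → ℝ) := hr.isBigO_one ℝ
  have h₁ := hrO.mul_isLittleO ((hA.mul_isLittleO hF).add
    ((hB.mul_isLittleO hG).congr_right fun i => by simp))
  have h₂ := hr1.mul_isBigO ((hA.mul hf).add ((hB.mul hg).congr_right fun i => by simp))
  have h₃ := h₁.add (h₂.congr_right fun i => by simp)
  refine h₃.congr (fun i => ?_) (fun i => by simp)
  simp only [Pi.sub_apply, Pi.mul_apply, Pi.add_apply, Pi.one_apply]
  ring

theorem isBigO_one_of_continuous {g : ℝ → ℝ} (hg : Continuous g) :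
    (fun q : ℕ × ℝ => g q.2) =O[atTop ×ˢ 𝓟 (Icc (0 : ℝ) 1)] (1 : ℕ × ℝ → ℝ) := by
  obtain ⟨C, hC⟩ := isCompact_Icc.exists_bound_of_continuousOn (s := Icc (0 : ℝ) 1) hg.continuousOn
  refine IsBigO.of_bound C ?_
  filter_upwards [tendsto_snd.eventually (eventually_principal.2 hC)] with q hq
  simpa using hq

theorem tendsto_natCast_mul_inv_natCast_add (k : ℝ) :
    Tendsto (fun n : ℕ => (n : ℝ) * ((n : ℝ) + k)⁻¹) atTop (nhds 1) := by
  have := tendsto_natCast_div_add_atTop k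
  simpa [div_eq_mul_inv] using this

/-- The leading coefficient of the odd central moment of order `2 * l + 1`. -/
noncomputable def oddMomentLimit (α β : ℝ) (l : ℕ) (x : ℝ) : ℝ :=
  (x * (1 - x)) ^ l *
    ((Nat.factorial l : ℝ) * 2 ^ l * (1 - 2 * x) *
        ∑ k ∈ Finset.Icc 1 l,
          (Nat.doubleFactorial (2 * k - 1) : ℝ) / (Nat.doubleFactorial (2 * k - 2) : ℝ) +
      (Nat.doubleFactorial (2 * l + 1) : ℝ) * (α + 1 - (α + β + 2) * x))

/-- The leading coefficient of the even central moment of order `2 * l`. -/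
noncomputable def evenMomentLimit (l : ℕ) (x : ℝ) : ℝ :=
  (Nat.doubleFactorial (2 * l - 1) : ℝ) * (x * (1 - x)) ^ l

theorem continuous_oddMomentLimit (α β : ℝ) (l : ℕ) : Continuous (oddMomentLimit α β l) := by
  unfold oddMomentLimit
  fun_prop

theorem continuous_evenMomentLimit (l : ℕ) : Continuous (evenMomentLimit l) := by
  unfold evenMomentLimit
  fun_prop

theorem evenMomentLimit_succ (l : ℕ) (x : ℝ) :
    evenMomentLimit (l + 1) x = (2 * l + 1) * (x * (1 - x)) * evenMomentLimit l x := by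
  have h : Nat.doubleFactorial (2 * (l + 1) - 1) =
      (2 * l + 1) * Nat.doubleFactorial (2 * l - 1) := by
    rw [show 2 * (l + 1) - 1 = 2 * l + 1 by omega, Nat.doubleFactorial_add_one]
  simp only [evenMomentLimit, h]
  push_cast
  ring

theorem oddMomentLimit_succ (α β : ℝ) (l : ℕ) (x : ℝ) :
    oddMomentLimit α β (l + 1) x =
      (α + 1 - (α + β + 2) * x + (2 * l + 2) * (1 - 2 * x)) * evenMomentLimit (l + 1) x +
        (2 * l + 2) * (x * (1 - x)) * oddMomentLimit α β l x := by
  have h : Nat.doubleFactorial (2 * (l + 1) + 1) =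
      (2 * l + 3) * Nat.doubleFactorial (2 * l + 1) := by
    rw [show 2 * (l + 1) + 1 = (2 * l + 1) + 2 by omega, Nat.doubleFactorial_add_two]
  have hl : (Nat.factorial l : ℝ) ≠ 0 := by positivity
  simp only [evenMomentLimit, oddMomentLimit, h, Finset.sum_Icc_succ_top (Nat.le_add_left 1 l),
    show 2 * (l + 1) - 1 = 2 * l + 1 by omega, show 2 * (l + 1) - 2 = 2 * l by omega,
    Nat.doubleFactorial_two_mul, Nat.factorial_succ]
  push_cast
  field_simp
  ring

/-- One step of the recurrence, passed to the limit after multiplication by `n ^ (k + 1)`. -/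
theorem isLittleO_pow_mul_TE_succ {α β : ℝ} (hα : -1 ≤ α) (hβ : -1 ≤ β) (m k : ℕ) {f g : ℝ → ℝ}
    (hf : Continuous f) (hg : Continuous g)
    (hF : (fun q : ℕ × ℝ => (q.1 : ℝ) ^ k * TE q.1 α β (m + 1) q.2 - f q.2)
      =o[atTop ×ˢ 𝓟 (Icc (0 : ℝ) 1)] (1 : ℕ × ℝ → ℝ))
    (hG : (fun q : ℕ × ℝ => (q.1 : ℝ) ^ k * TE q.1 α β m q.2 - g q.2)
      =o[atTop ×ˢ 𝓟 (Icc (0 : ℝ) 1)] (1 : ℕ × ℝ → ℝ)) :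
    (fun q : ℕ × ℝ => (q.1 : ℝ) ^ (k + 1) * TE q.1 α β (m + 2) q.2 -
      ((α + 1 - (α + β + 2) * q.2 + (m + 1) * (1 - 2 * q.2)) * f q.2 +
        (m + 1) * (q.2 * (1 - q.2)) * g q.2))
      =o[atTop ×ˢ 𝓟 (Icc (0 : ℝ) 1)] (1 : ℕ × ℝ → ℝ) := by
  have h := tendsto_mul_add_mul_of_isBigO_one
    ((tendsto_natCast_mul_inv_natCast_add (α + β + 2 + (m + 1))).comp
      (tendsto_fst (g := 𝓟 (Icc (0 : ℝ) 1))))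
    (isBigO_one_of_continuous (g := fun x => α + 1 - (α + β + 2) * x + (m + 1) * (1 - 2 * x))
      (by fun_prop))
    (isBigO_one_of_continuous (g := fun x => (m + 1) * (x * (1 - x))) (by fun_prop))
    (isBigO_one_of_continuous hf) (isBigO_one_of_continuous hg) hF hG
  refine h.congr' ?_ EventuallyEq.rfl
  filter_upwards [tendsto_fst.eventually (eventually_gt_atTop (0 : ℕ)),
    tendsto_snd.eventually (eventually_principal.2 fun x (hx : x ∈ Icc (0 : ℝ) 1) => hx)]
    with q hn hx
  have hrec := TE_succ hα hβ (Nat.cast_pos.2 hn) hx (m + 1)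
  push_cast [Nat.add_sub_cancel] at hrec
  simp only [Pi.sub_apply, Pi.mul_apply, Pi.add_apply, Function.comp_apply]
  rw [show m + 2 = m + 1 + 1 by rfl, hrec]
  ring

theorem isLittleO_pow_mul_of_pow_succ {F : ℕ × ℝ → ℝ} {f : ℝ → ℝ} {k : ℕ} (hf : Continuous f)
    (hF : (fun q : ℕ × ℝ => (q.1 : ℝ) ^ (k + 1) * F q - f q.2)
      =o[atTop ×ˢ 𝓟 (Icc (0 : ℝ) 1)] (1 : ℕ × ℝ → ℝ)) :
    (fun q : ℕ × ℝ => (q.1 : ℝ) ^ k * F q - 0)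
      =o[atTop ×ˢ 𝓟 (Icc (0 : ℝ) 1)] (1 : ℕ × ℝ → ℝ) := by
  have hO := hF.isBigO.add (isBigO_one_of_continuous hf)
  have hinv : (fun q : ℕ × ℝ => (q.1 : ℝ)⁻¹) =o[atTop ×ˢ 𝓟 (Icc (0 : ℝ) 1)] (1 : ℕ × ℝ → ℝ) :=
    (isLittleO_one_iff ℝ).2 (tendsto_inv_atTop_nhds_zero_nat.comp tendsto_fst)
  refine (hinv.mul_isBigO hO).congr' ?_ (Eventually.of_forall fun q => by simp)
  filter_upwards [tendsto_fst.eventually (eventually_gt_atTop (0 : ℕ))] with q hn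
  have : (q.1 : ℝ) ≠ 0 := by exact_mod_cast hn.ne'
  field_simp
  ring

theorem isLittleO_moments_sub_limits {α β : ℝ} (hα : -1 ≤ α) (hβ : -1 ≤ β) (l : ℕ) :
    (fun q : ℕ × ℝ => (q.1 : ℝ) ^ l * TE q.1 α β (2 * l) q.2 - evenMomentLimit l q.2)
        =o[atTop ×ˢ 𝓟 (Icc (0 : ℝ) 1)] (1 : ℕ × ℝ → ℝ) ∧
      (fun q : ℕ × ℝ =>
          (q.1 : ℝ) ^ (l + 1) * TE q.1 α β (2 * l + 1) q.2 - oddMomentLimit α β l q.2)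
        =o[atTop ×ˢ 𝓟 (Icc (0 : ℝ) 1)] (1 : ℕ × ℝ → ℝ) := by
  have hpos : ∀ᶠ q : ℕ × ℝ in atTop ×ˢ 𝓟 (Icc (0 : ℝ) 1), 0 < q.1 ∧ q.2 ∈ Icc (0 : ℝ) 1 :=
    (tendsto_fst.eventually (eventually_gt_atTop (0 : ℕ))).and
      (tendsto_snd.eventually (eventually_principal.2 fun x hx => hx))
  induction l with
  | zero =>
    constructor
    · refine (isLittleO_zero _ _).congr' ?_ EventuallyEq.rfl
      filter_upwards [hpos] with q ⟨hn, hx⟩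
      simp [evenMomentLimit, TE_zero hα hβ (Nat.cast_pos.2 hn) hx]
    · have hc := isBigO_one_of_continuous (g := fun x => α + 1 - (α + β + 2) * x) (by fun_prop)
      have hr : (fun q : ℕ × ℝ => (q.1 : ℝ) * ((q.1 : ℝ) + (α + β + 2))⁻¹ - 1)
          =o[atTop ×ˢ 𝓟 (Icc (0 : ℝ) 1)] (1 : ℕ × ℝ → ℝ) := by
        refine (isLittleO_one_iff ℝ).2 ?_
        simpa using ((tendsto_natCast_mul_inv_natCast_add (α + β + 2)).comp
          (tendsto_fst (g := 𝓟 (Icc (0 : ℝ) 1)))).sub (tendsto_const_nhds (x := (1 : ℝ)))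
      refine (hr.mul_isBigO hc).congr' ?_ (Eventually.of_forall fun q => by simp)
      filter_upwards [hpos] with q ⟨hn, hx⟩
      have hrec := TE_succ hα hβ (Nat.cast_pos.2 hn) hx 0
      simp only [TE_zero hα hβ (Nat.cast_pos.2 hn) hx, CharP.cast_eq_zero] at hrec
      simp [oddMomentLimit, hrec]
      ring
  | succ l ih =>
    obtain ⟨ihe, iho⟩ := ih
    have he : (fun q : ℕ × ℝ =>
          (q.1 : ℝ) ^ (l + 1) * TE q.1 α β (2 * l + 2) q.2 - evenMomentLimit (l + 1) q.2)
        =o[atTop ×ˢ 𝓟 (Icc (0 : ℝ) 1)] (1 : ℕ × ℝ → ℝ) := by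
      refine (isLittleO_pow_mul_TE_succ hα hβ (2 * l) l continuous_const
        (continuous_evenMomentLimit l)
        (isLittleO_pow_mul_of_pow_succ (continuous_oddMomentLimit α β l) iho) ihe).congr_left ?_
      intro q
      rw [evenMomentLimit_succ]
      push_cast
      ring
    refine ⟨he, (isLittleO_pow_mul_TE_succ hα hβ (2 * l + 1) (l + 1)
      (continuous_evenMomentLimit (l + 1)) (continuous_oddMomentLimit α β l) he iho).congr_left ?_⟩
    intro q
    rw [oddMomentLimit_succ]
    push_cast
    rw [show 2 * (l + 1) + 1 = 2 * l + 1 + 2 by ring]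
    ring

end

theorem odd_moment_asymptotics (α β : ℝ) (hα : α ≥ -1) (hβ : β ≥ -1)
    (l : ℕ) (hl : 1 ≤ l) :
    TendstoUniformlyOn (fun (n : ℕ) (x : ℝ) => (n : ℝ) ^ l * TE n α β (2 * l - 1) x)
      (fun x => (x * (1 - x)) ^ (l - 1) *
        ((Nat.factorial (l - 1) : ℝ) * 2 ^ (l - 1) * (1 - 2 * x) *
            ∑ k ∈ Finset.Icc 1 (l - 1), (Nat.doubleFactorial (2 * k - 1) : ℝ) / (Nat.doubleFactorial (2 * k - 2) : ℝ) +
          (Nat.doubleFactorial (2 * l - 1) : ℝ) * (α + 1 - (α + β + 2) * x)))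
      atTop (Set.Icc (0:ℝ) 1) := by
  obtain ⟨k, rfl⟩ := Nat.exists_eq_add_of_le' hl
  have h := (Asymptotics.isLittleO_one_iff ℝ).1 (isLittleO_moments_sub_limits hα hβ k).2
  simp only [Nat.add_sub_cancel, show 2 * (k + 1) - 1 = 2 * k + 1 by omega]
  rw [tendstoUniformlyOn_iff_tendsto, tendsto_uniformity_iff_dist_tendsto_zero]
  refine (tendsto_zero_iff_norm_tendsto_zero.1 h).congr fun q => ?_
  rw [dist_comm, Real.dist_eq, Real.norm_eq_abs, oddMomentLimit]
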